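/- Let T be an ℝ-tree and let G be a group with a non-nesting action on T by weak homeomorphisms. If g ∈ G is elliptic, then its fixed-point set T^g is a closed convex subset of T. -/

import Mathlib

open Set

/-- A topologically embedded arc in `T` joining `x` to `y`, given as a subset:
the image of a continuous injective map on `[0,1]` with endpoints `x` and `y`
(such a map is automatically a topological embedding). -/
def IsArc {T : Type*} [MetricSpace T] (A : Set T) (x y : T) : Prop :=
  ∃ f : ℝ → T, ContinuousOn f (Icc (0 : ℝ) 1) ∧ InjOn f (Icc (0 : ℝ) 1) ∧
    f '' Icc (0 : ℝ) 1 = A ∧ f 0 = x ∧ f 1 = y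

/-- `A ⊆ T` is isometric to a closed bounded interval of `ℝ`. -/
def IsIsometricToInterval {T : Type*} [MetricSpace T] (A : Set T) : Prop :=
  ∃ (a b : ℝ) (f : ℝ → T), a ≤ b ∧
    (∀ s ∈ Icc a b, ∀ t ∈ Icc a b, dist (f s) (f t) = |s - t|) ∧
    f '' Icc a b = A

/-- An `ℝ`-tree: a metric space in which any two distinct points are joined by a
unique topologically embedded arc, and this arc is isometric to a closed bounded
interval of `ℝ`. -/
structure IsRTree (T : Type*) [MetricSpace T] : Prop where
  arc_existsUnique : ∀ ⦃x y : T⦄, x ≠ y → ∃! A : Set T, IsArc A x y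
  arc_isometric : ∀ ⦃x y : T⦄, x ≠ y → ∀ A : Set T, IsArc A x y → IsIsometricToInterval A

open scoped Classical in
/-- The segment `[x,y]`: the unique arc joining `x` to `y` if `x ≠ y`
(computed as the intersection of all such arcs), and `{x}` if `x = y`. -/
noncomputable def seg {T : Type*} [MetricSpace T] (x y : T) : Set T :=
  if x = y then {x} else ⋂₀ {A : Set T | IsArc A x y}

/-- Betweenness: `Btwn x y z` iff `x ∈ [y,z] \ {y,z}`. -/
def Btwn {T : Type*} [MetricSpace T] (x y z : T) : Prop :=
  x ∈ seg y z ∧ x ≠ y ∧ x ≠ z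

/-- A weak homeomorphism of `T`: a bijection preserving the betweenness relation. -/
def IsWeakHomeo {T : Type*} [MetricSpace T] (g : T → T) : Prop :=
  Function.Bijective g ∧ ∀ x y z : T, Btwn x y z ↔ Btwn (g x) (g y) (g z)

/-- Convex subsets (subtrees) of `T`. -/
def ConvexSubtree {T : Type*} [MetricSpace T] (S : Set T) : Prop :=
  ∀ x ∈ S, ∀ y ∈ S, seg x y ⊆ S

/-- The action of `G` on `T` is by weak homeomorphisms. -/
def ActsByWeakHomeos (G T : Type*) [Group G] [MulAction G T] [MetricSpace T] : Prop :=
  ∀ g : G, IsWeakHomeo (fun t : T => g • t)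

/-- The action of `G` on `T` is non-nesting: no segment is mapped properly into itself. -/
def NonNesting (G T : Type*) [Group G] [MulAction G T] [MetricSpace T] : Prop :=
  ∀ (g : G) (x y : T), ¬ ((fun t : T => g • t) '' seg x y ⊂ seg x y)

/-- The fixed-point set `T^g` of a group element. -/
def fixedSet (T : Type*) {G : Type*} [Group G] [MulAction G T] (g : G) : Set T :=
  {t : T | g • t = t}

/-- `x, y, z` span a tripod: the median of `x, y, z` lies in none of `{x,y,z}`. -/
def IsTripod {T : Type*} [MetricSpace T] (x y z : T) : Prop :=
  ∀ c ∈ seg x y ∩ seg y z ∩ seg z x, c ≠ x ∧ c ≠ y ∧ c ≠ z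

/-- `S` contains no tripod. -/
def NoTripod {T : Type*} [MetricSpace T] (S : Set T) : Prop :=
  ¬ ∃ x y z : T, IsTripod x y z ∧ seg x y ∪ seg y z ∪ seg z x ⊆ S

/-- A line: a convex subset containing no tripod, maximal for inclusion. -/
def IsLine {T : Type*} [MetricSpace T] (L : Set T) : Prop :=
  ConvexSubtree L ∧ NoTripod L ∧
    ∀ L' : Set T, ConvexSubtree L' → NoTripod L' → L ⊆ L' → L' = L

/-- `L` is an axis for `g`: a `g`-invariant line. -/
def IsAxis {G T : Type*} [Group G] [MulAction G T] [MetricSpace T] (g : G) (L : Set T) :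
    Prop :=
  IsLine L ∧ (fun t : T => g • t) '' L = L


lemma isArc_concat {T : Type*} [MetricSpace T] {A B : Set T} {x z y : T}
    (hA : IsArc A x z) (hB : IsArc B z y) (hAB : ∀ w ∈ A, w ∈ B → w = z) :
    IsArc (A ∪ B) x y := by
  obtain ⟨f, fc, fi, rfl, f0, f1⟩ := hA
  obtain ⟨k, kc, ki, rfl, k0, k1⟩ := hB
  set h : ℝ → T := fun t => if t ≤ 1/2 then f (2*t) else k (2*t-1) with hh
  have h1 : ∀ t, t ≤ 1/2 → h t = f (2*t) := fun t ht => by simp only [hh]; rw [if_pos ht]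
  have h2 : ∀ t, 1/2 ≤ t → h t = k (2*t-1) := fun t ht => by
    rcases ht.eq_or_lt with rfl | ht
    · rw [h1 _ le_rfl]; norm_num [f1, k0]
    · simp only [hh]; rw [if_neg (not_le.2 ht)]
  have key : ∀ s t : ℝ, s ∈ Icc (0:ℝ) 1 → t ∈ Icc (0:ℝ) 1 → s ≤ 1/2 → 1/2 ≤ t → h s = h t →
      s = t := by
    intro s t hs ht hs2 ht2 e
    rw [h1 s hs2, h2 t ht2] at e
    have ms : 2*s ∈ Icc (0:ℝ) 1 := ⟨by linarith [hs.1], by linarith⟩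
    have mt : 2*t-1 ∈ Icc (0:ℝ) 1 := ⟨by linarith, by linarith [ht.2]⟩
    have e1 := hAB (f (2*s)) ⟨_, ms, rfl⟩ ⟨_, mt, e.symm⟩
    have a1 := fi ms ⟨zero_le_one, le_rfl⟩ (e1.trans f1.symm)
    have a2 := ki mt ⟨le_rfl, zero_le_one⟩ ((e.symm.trans e1).trans k0.symm)
    linarith
  refine ⟨h, ?_, ?_, ?_, ?_, ?_⟩
  · have : Icc (0:ℝ) 1 = Icc 0 (1/2) ∪ Icc (1/2) 1 :=
      (Icc_union_Icc_eq_Icc (by norm_num) (by norm_num)).symm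
    rw [this]
    refine ContinuousOn.union_of_isClosed ?_ ?_ isClosed_Icc isClosed_Icc
    · refine (fc.comp (f := fun t : ℝ => 2*t) (by fun_prop) ?_).congr fun t ht => h1 t ht.2
      intro t ht; exact ⟨by linarith [ht.1], by linarith [ht.2]⟩
    · refine (kc.comp (f := fun t : ℝ => 2*t-1) (by fun_prop) ?_).congr fun t ht => h2 t ht.1
      intro t ht; exact ⟨by linarith [ht.1], by linarith [ht.2]⟩
  · intro s hs t ht e
    rcases le_total s (1/2) with a | a <;> rcases le_total t (1/2) with b | b
    · rw [h1 s a, h1 t b] at e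
      have := fi (x₁ := 2*s) (x₂ := 2*t) ⟨by linarith [hs.1], by linarith⟩
        ⟨by linarith [ht.1], by linarith⟩ e
      linarith
    · exact key s t hs ht a b e
    · exact (key t s ht hs b a e.symm).symm
    · rw [h2 s a, h2 t b] at e
      have := ki (x₁ := 2*s-1) (x₂ := 2*t-1) ⟨by linarith, by linarith [hs.2]⟩
        ⟨by linarith, by linarith [ht.2]⟩ e
      linarith
  · ext w
    constructor
    · rintro ⟨t, ht, rfl⟩
      rcases le_total t (1/2) with a | a
      · left; rw [h1 t a]; exact ⟨_, ⟨by linarith [ht.1], by linarith⟩, rfl⟩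
      · right; rw [h2 t a]; exact ⟨_, ⟨by linarith, by linarith [ht.2]⟩, rfl⟩
    · rintro (⟨t, ht, rfl⟩ | ⟨t, ht, rfl⟩)
      · refine ⟨t/2, ⟨by linarith [ht.1], by linarith [ht.2]⟩, ?_⟩
        rw [h1 _ (by linarith [ht.2])]; congr 1; ring
      · refine ⟨(t+1)/2, ⟨by linarith [ht.1], by linarith [ht.2]⟩, ?_⟩
        rw [h2 _ (by linarith [ht.1])]; congr 1; ring
  · rw [h1 0 (by norm_num)]; simpa using f0
  · rw [h2 1 (by norm_num)]; norm_num [k1]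

lemma isArc_symm {T : Type*} [MetricSpace T] {A : Set T} {x y : T}
    (hA : IsArc A x y) : IsArc A y x := by
  obtain ⟨f, fc, fi, rfl, f0, f1⟩ := hA
  refine ⟨fun t => f (1 - t), ?_, ?_, ?_, by simpa using f1, by simpa using f0⟩
  · refine fc.comp (f := fun t : ℝ => 1 - t) (by fun_prop) ?_
    intro t ht; exact ⟨by linarith [ht.2], by linarith [ht.1]⟩
  · intro s hs t ht e
    have := fi (x₁ := 1 - s) (x₂ := 1 - t) ⟨by linarith [hs.2], by linarith [hs.1]⟩
        ⟨by linarith [ht.2], by linarith [ht.1]⟩ e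
    linarith
  · ext w
    constructor
    · rintro ⟨t, ht, rfl⟩
      exact ⟨1 - t, ⟨by linarith [ht.2], by linarith [ht.1]⟩, rfl⟩
    · rintro ⟨t, ht, rfl⟩
      exact ⟨1 - t, ⟨by linarith [ht.2], by linarith [ht.1]⟩, by simp⟩

lemma isArc_of_isom {T : Type*} [MetricSpace T] {a b : ℝ} (hab : a < b) {f : ℝ → T}
    (hf : ∀ s ∈ Icc a b, ∀ t ∈ Icc a b, dist (f s) (f t) = |s - t|) :
    IsArc (f '' Icc a b) (f a) (f b) := by
  have hba : 0 < b - a := by linarith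
  have mem : ∀ t ∈ Icc (0:ℝ) 1, a + t * (b - a) ∈ Icc a b := fun t ht =>
    ⟨by nlinarith [ht.1], by nlinarith [ht.2]⟩
  have fc : ContinuousOn f (Icc a b) := by
    rw [Metric.continuousOn_iff]
    intro t ht ε hε
    refine ⟨ε, hε, fun s hs h => ?_⟩
    rwa [hf s hs t ht, ← Real.dist_eq]
  refine ⟨fun t => f (a + t * (b - a)), ?_, ?_, ?_, by simp, by simp⟩
  · exact fc.comp (f := fun t : ℝ => a + t * (b - a)) (by fun_prop) mem
  · intro s hs t ht e
    have := hf _ (mem s hs) _ (mem t ht)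
    simp only at e
    rw [e, dist_self] at this
    have h0 := abs_eq_zero.1 this.symm
    have : (s - t) * (b - a) = 0 := by linarith
    rcases mul_eq_zero.1 this with h | h <;> linarith
  · ext w
    constructor
    · rintro ⟨t, ht, rfl⟩
      exact ⟨_, mem t ht, rfl⟩
    · rintro ⟨t, ht, rfl⟩
      refine ⟨(t - a) / (b - a), ⟨div_nonneg (by linarith [ht.1]) hba.le, ?_⟩, ?_⟩
      · rw [div_le_one hba]; linarith [ht.2]
      · simp only; congr 1; field_simp; ring

lemma seg_eq_of_isArc {T : Type*} [MetricSpace T] (hT : IsRTree T) {A : Set T} {x y : T}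
    (hxy : x ≠ y) (hA : IsArc A x y) : seg x y = A := by
  have : {B : Set T | IsArc B x y} = {A} := by
    ext B
    exact ⟨fun h => (hT.arc_existsUnique hxy).unique h hA, fun h => by rw [h]; exact hA⟩
  rw [seg, if_neg hxy, this, sInter_singleton]

lemma isArc_seg {T : Type*} [MetricSpace T] (hT : IsRTree T) {x y : T}
    (hxy : x ≠ y) : IsArc (seg x y) x y := by
  obtain ⟨A, hA, -⟩ := hT.arc_existsUnique hxy
  rwa [seg_eq_of_isArc hT hxy hA]

lemma seg_comm' {T : Type*} [MetricSpace T] (hT : IsRTree T) (x y : T) :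
    seg x y = seg y x := by
  by_cases h : x = y
  · rw [h]
  · exact seg_eq_of_isArc hT h (isArc_symm (isArc_seg hT (Ne.symm h)))

lemma left_mem_seg {T : Type*} [MetricSpace T] (hT : IsRTree T) (x y : T) :
    x ∈ seg x y := by
  by_cases h : x = y
  · rw [seg, if_pos h]; rfl
  · obtain ⟨f, -, -, e, f0, -⟩ := isArc_seg hT h
    rw [← e]; exact ⟨0, ⟨le_rfl, zero_le_one⟩, f0⟩

lemma right_mem_seg {T : Type*} [MetricSpace T] (hT : IsRTree T) (x y : T) :
    y ∈ seg x y := by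
  rw [seg_comm' hT]; exact left_mem_seg hT y x

/-- parametrization by arclength, up to orientation -/
lemma seg_param {T : Type*} [MetricSpace T] (hT : IsRTree T) (x y : T) :
    ∃ (a b : ℝ) (f : ℝ → T), a ≤ b ∧
    (∀ s ∈ Icc a b, ∀ t ∈ Icc a b, dist (f s) (f t) = |s - t|) ∧
    f '' Icc a b = seg x y ∧ (f a = x ∧ f b = y ∨ f a = y ∧ f b = x) := by
  by_cases h : x = y
  · refine ⟨0, 0, fun _ => x, le_rfl, ?_, ?_, Or.inl ⟨rfl, h⟩⟩
    · intro s hs t ht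
      simp at hs ht
      simp [hs, ht]
    · rw [seg, if_pos h]; simp
  obtain ⟨a, b, f, hab, hf, e⟩ := hT.arc_isometric h _ (isArc_seg hT h)
  refine ⟨a, b, f, hab, hf, e, ?_⟩
  have inj : ∀ s ∈ Icc a b, ∀ t ∈ Icc a b, f s = f t → s = t := by
    intro s hs t ht e
    have := hf s hs t ht
    rw [e, dist_self] at this
    linarith [abs_eq_zero.1 this.symm]
  have main : ∀ s ∈ Icc a b, ∀ t ∈ Icc a b, s < t → f '' Icc a b = seg (f s) (f t) →
      s = a ∧ t = b := by
    intro s hs t ht hst e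
    have ar := isArc_of_isom hst (f := f) (fun u hu v hv =>
      hf u ⟨hs.1.trans hu.1, hu.2.trans ht.2⟩ v ⟨hs.1.trans hv.1, hv.2.trans ht.2⟩)
    have hne : f s ≠ f t := fun h => hst.ne (inj s hs t ht h)
    rw [seg_eq_of_isArc hT hne ar] at e
    have ma : f a ∈ f '' Icc s t := e ▸ ⟨a, ⟨le_rfl, hab⟩, rfl⟩
    have mb : f b ∈ f '' Icc s t := e ▸ ⟨b, ⟨hab, le_rfl⟩, rfl⟩
    obtain ⟨u, hu, hu'⟩ := ma
    obtain ⟨v, hv, hv'⟩ := mb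
    have ua := inj u ⟨hs.1.trans hu.1, hu.2.trans ht.2⟩ a ⟨le_rfl, hab⟩ hu'
    have vb := inj v ⟨hs.1.trans hv.1, hv.2.trans ht.2⟩ b ⟨hab, le_rfl⟩ hv'
    exact ⟨le_antisymm (ua ▸ hu.1) hs.1, le_antisymm ht.2 (vb ▸ hv.2)⟩
  obtain ⟨s, hs, rfl⟩ : x ∈ f '' Icc a b := e ▸ left_mem_seg hT x y
  obtain ⟨t, ht, rfl⟩ : y ∈ f '' Icc a b := e ▸ right_mem_seg hT _ y
  rcases lt_trichotomy s t with hst | hst | hst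
  · obtain ⟨rfl, rfl⟩ := main s hs t ht hst e
    exact Or.inl ⟨rfl, rfl⟩
  · exact absurd (by rw [hst]) h
  · obtain ⟨rfl, rfl⟩ := main t ht s hs hst (e.trans (seg_comm' hT _ _))
    exact Or.inr ⟨rfl, rfl⟩

lemma mem_seg_iff {T : Type*} [MetricSpace T] (hT : IsRTree T) {x y z : T} :
    z ∈ seg x y ↔ dist x z + dist z y = dist x y := by
  have fwd : ∀ {x y z : T}, z ∈ seg x y → dist x z + dist z y = dist x y := by
    intro x y z hz
    obtain ⟨a, b, f, hab, hf, e, ends⟩ := seg_param hT x y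
    rw [← e] at hz
    obtain ⟨t, ht, rfl⟩ := hz
    have ha : a ∈ Icc a b := ⟨le_rfl, hab⟩
    have hb : b ∈ Icc a b := ⟨hab, le_rfl⟩
    rcases ends with ⟨rfl, rfl⟩ | ⟨rfl, rfl⟩
    · rw [hf a ha t ht, hf t ht b hb, hf a ha b hb, abs_of_nonpos (by linarith [ht.1]),
        abs_of_nonpos (by linarith [ht.2]), abs_of_nonpos (by linarith)]; ring
    · rw [hf b hb t ht, hf t ht a ha, hf b hb a ha, abs_of_nonneg (by linarith [ht.2]),
        abs_of_nonneg (by linarith [ht.1]), abs_of_nonneg (by linarith)]; ring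
  refine ⟨fwd, fun h => ?_⟩
  by_cases hxz : x = z
  · rw [← hxz]; exact left_mem_seg hT x y
  by_cases hzy : z = y
  · rw [hzy]; exact right_mem_seg hT x y
  have hxy : x ≠ y := by
    rintro rfl
    rw [dist_self] at h
    have := dist_pos.2 hxz
    have := dist_pos.2 hzy
    linarith
  rw [seg_eq_of_isArc hT hxy (isArc_concat (isArc_seg hT hxz) (isArc_seg hT hzy) ?_)]
  · exact Or.inl (right_mem_seg hT x z)
  · intro w h1 h2
    have h1 := fwd h1
    have h2 := fwd h2
    rw [dist_comm z w] at h2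
    have := dist_triangle x w y
    exact dist_le_zero.1 (by linarith)

lemma seg_compact {T : Type*} [MetricSpace T] (hT : IsRTree T) (x y : T) :
    IsCompact (seg x y) := by
  by_cases h : x = y
  · rw [seg, if_pos h]; exact isCompact_singleton
  · obtain ⟨f, fc, -, e, -, -⟩ := isArc_seg hT h
    rw [← e]; exact isCompact_Icc.image_of_continuousOn fc

lemma seg_total {T : Type*} [MetricSpace T] (hT : IsRTree T) {x y z w : T}
    (hz : z ∈ seg x y) (hw : w ∈ seg x y) : z ∈ seg x w ∨ w ∈ seg x z := by
  obtain ⟨a, b, f, hab, hf, e, ends⟩ := seg_param hT x y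
  rw [← e] at hz hw
  obtain ⟨s, hs, rfl⟩ := hz
  obtain ⟨t, ht, rfl⟩ := hw
  have ha : a ∈ Icc a b := ⟨le_rfl, hab⟩
  have hb : b ∈ Icc a b := ⟨hab, le_rfl⟩
  rw [mem_seg_iff hT, mem_seg_iff hT]
  rcases ends with ⟨rfl, -⟩ | ⟨-, rfl⟩
  · rw [hf a ha s hs, hf a ha t ht, hf s hs t ht, hf t ht s hs]
    rw [abs_of_nonpos (a := a - s) (by linarith [hs.1]),
      abs_of_nonpos (a := a - t) (by linarith [ht.1]), abs_sub_comm t s]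
    rcases le_total s t with h | h
    · left; rw [abs_of_nonpos (by linarith)]; ring
    · right; rw [abs_of_nonneg (by linarith)]; ring
  · rw [hf b hb s hs, hf b hb t ht, hf s hs t ht, hf t ht s hs]
    rw [abs_of_nonneg (a := b - s) (by linarith [hs.2]),
      abs_of_nonneg (a := b - t) (by linarith [ht.2]), abs_sub_comm t s]
    rcases le_total s t with h | h
    · right; rw [abs_of_nonpos (by linarith)]; ring
    · left; rw [abs_of_nonneg (by linarith)]; ring

lemma seg_subset {T : Type*} [MetricSpace T] (hT : IsRTree T) {x y z : T}
    (hz : z ∈ seg x y) : seg x z ⊆ seg x y := by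
  intro w hw
  rw [mem_seg_iff hT] at *
  have := dist_triangle x w y
  have := dist_triangle w z y
  linarith

lemma exists_gate {T : Type*} [MetricSpace T] (hT : IsRTree T) (p x y : T) :
    ∃ c, c ∈ seg p x ∧ c ∈ seg p y ∧ dist c x ≤ dist y x := by
  obtain ⟨c, ⟨c1, c2⟩, hc⟩ := ((seg_compact hT p x).inter (seg_compact hT p y)).exists_isMinOn
    ⟨p, left_mem_seg hT p x, left_mem_seg hT p y⟩
    (f := fun w => dist w x) (by fun_prop)
  refine ⟨c, c1, c2, ?_⟩
  have hmin : ∀ w, w ∈ seg p x → w ∈ seg p y → dist c x ≤ dist w x :=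
    fun w h1 h2 => hc ⟨h1, h2⟩
  by_cases hyx : y = x
  · subst hyx; exact hmin _ c1 c2 |>.trans (hmin y (right_mem_seg hT p y) (right_mem_seg hT p y))
  by_cases hyc : y = c
  · rw [hyc]
  by_cases hcx : c = x
  · rw [hcx, dist_self]; exact dist_nonneg
  have hs := seg_eq_of_isArc hT hyx (isArc_concat (isArc_seg hT hyc) (isArc_seg hT hcx) (by
    intro w h1 h2
    have k1 : w ∈ seg p y := by
      rw [seg_comm' hT] at c2 ⊢
      exact seg_subset hT c2 h1
    have k2 : w ∈ seg p x := by
      rw [seg_comm' hT] at c1 h2 ⊢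
      exact seg_subset hT c1 h2
    have := hmin w k2 k1
    rw [mem_seg_iff hT, dist_comm c w] at h2
    exact dist_le_zero.1 (by linarith)))
  have hm : c ∈ seg y x := hs ▸ Or.inl (right_mem_seg hT y c)
  rw [mem_seg_iff hT] at hm
  have := dist_nonneg (x := y) (y := c)
  linarith

lemma smul_mem_seg {T : Type*} [MetricSpace T] (hT : IsRTree T)
    {G : Type*} [Group G] [MulAction G T] (hact : ActsByWeakHomeos G T) (g : G) {x y z : T}
    (hz : z ∈ seg x y) : g • z ∈ seg (g • x) (g • y) := by
  by_cases h1 : z = x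
  · rw [h1]; exact left_mem_seg hT _ _
  by_cases h2 : z = y
  · rw [h2]; exact right_mem_seg hT _ _
  exact (((hact g).2 z x y).1 ⟨hz, h1, h2⟩).1

lemma fixed_of_mem {T : Type*} [MetricSpace T] (hT : IsRTree T)
    {G : Type*} [Group G] [MulAction G T] (hact : ActsByWeakHomeos G T) (hnn : NonNesting G T)
    (g : G) {x z : T} (hx : g • x = x) (hz : g • z ∈ seg x z) : g • z = z := by
  have sub : (fun t : T => g • t) '' seg x z ⊆ seg x z := by
    rintro _ ⟨w, hw, rfl⟩
    have := smul_mem_seg hT hact g hw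
    rw [hx] at this
    exact seg_subset hT hz this
  have hm : z ∈ (fun t : T => g • t) '' seg x z := by
    by_contra h
    exact hnn g x z ⟨sub, fun h' => h (h' (right_mem_seg hT x z))⟩
  obtain ⟨w, hw, e⟩ := hm
  have h2 := smul_mem_seg hT hact g hw
  simp only at e
  rw [e, hx] at h2
  rw [mem_seg_iff hT] at hz h2
  rw [dist_comm z] at h2
  exact dist_le_zero.1 (by linarith)

lemma fixed_of_mem' {T : Type*} [MetricSpace T] (hT : IsRTree T)
    {G : Type*} [Group G] [MulAction G T] (hact : ActsByWeakHomeos G T) (hnn : NonNesting G T)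
    (g : G) {x z : T} (hx : g • x = x) (hz : z ∈ seg x (g • z)) : g • z = z := by
  have hx' : g⁻¹ • x = x := by rw [inv_smul_eq_iff, hx]
  have := smul_mem_seg hT hact g⁻¹ hz
  rw [hx', inv_smul_smul] at this
  have := fixed_of_mem hT hact hnn g⁻¹ hx' this
  rw [inv_smul_eq_iff] at this
  exact this.symm

/-- For a non-nesting action by weak homeomorphisms on an `ℝ`-tree,
the fixed-point set of an elliptic element is closed and convex. -/
theorem fixedSet_isClosed_and_convex_of_elliptic
    {T : Type*} [MetricSpace T] (hT : IsRTree T)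
    {G : Type*} [Group G] [MulAction G T]
    (hact : ActsByWeakHomeos G T) (hnn : NonNesting G T)
    (g : G) (hg : ∃ t : T, g • t = t) :
    IsClosed (fixedSet T g) ∧ ConvexSubtree (fixedSet T g) := by
  have conv : ConvexSubtree (fixedSet T g) := by
    intro x hx y hy z hz
    simp only [fixedSet, mem_ofPred_eq] at hx hy ⊢
    have h2 := smul_mem_seg hT hact g hz
    rw [hx, hy] at h2
    rcases seg_total hT hz h2 with h | h
    · exact fixed_of_mem' hT hact hnn g hx h
    · exact fixed_of_mem hT hact hnn g hx h
  refine ⟨isClosed_of_closure_subset fun x hx => ?_, conv⟩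
  obtain ⟨p, hp⟩ := hg
  refine fixed_of_mem' hT hact hnn g hp ?_
  rw [← (seg_compact hT p (g • x)).isClosed.closure_eq]
  rw [Metric.mem_closure_iff] at hx ⊢
  intro ε hε
  obtain ⟨y, hy, hd⟩ := hx ε hε
  obtain ⟨c, c1, c2, c3⟩ := exists_gate hT p x y
  have hc : g • c = c := conv p hp y hy c2
  have h2 := smul_mem_seg hT hact g c1
  rw [hp, hc] at h2
  refine ⟨c, h2, ?_⟩
  rw [dist_comm] at hd ⊢
  linarith
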